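/- Let χ₁, χ₂ be primitive Dirichlet characters of conductors q₁, q₂ respectively, with q₁, q₂ > 1 and χ₁(−1)χ₂(−1) = 1, and let γ = (a b; c d) ∈ Γ₀(q₁q₂). Then the function z ↦ f_{χ₁,χ₂}(γ·z) − (χ₁·conj(χ₂))(d)·f_{χ₁,χ₂}(z) is constant on the upper half-plane ℍ; that is, for all z, w ∈ ℍ, f_{χ₁,χ₂}(γ·z) − (χ₁·conj(χ₂))(d)·f_{χ₁,χ₂}(z) = f_{χ₁,χ₂}(γ·w) − (χ₁·conj(χ₂))(d)·f_{χ₁,χ₂}(w). -/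

import Mathlib

open Complex

/-- `e(w) = exp(2πiw)`. -/
noncomputable def eC (w : ℂ) : ℂ := Complex.exp (2 * Real.pi * Complex.I * w)

/-- The holomorphic part `f_{χ₁,χ₂}(z) = ∑_{l≥1} ∑_{k≥1} (χ₁(l) conj(χ₂)(k) / l) e(klz)`. -/
noncomputable def fE {q₁ q₂ : ℕ} (χ₁ : DirichletCharacter ℂ q₁)
    (χ₂ : DirichletCharacter ℂ q₂) (z : ℂ) : ℂ :=
  ∑' l : ℕ+, ∑' k : ℕ+,
    χ₁ ((l : ℕ) : ZMod q₁) * (starRingEnd ℂ) (χ₂ ((k : ℕ) : ZMod q₂)) / (l : ℂ)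
      * eC ((k : ℂ) * (l : ℂ) * z)

/-- The Gauss sum `τ(χ) = ∑_{n mod q} χ(n) e(n/q)`. -/
noncomputable def gaussSum' {q : ℕ} (χ : DirichletCharacter ℂ q) : ℂ :=
  ∑ n ∈ Finset.range q, χ ((n : ℕ) : ZMod q) * eC ((n : ℂ) / (q : ℂ))

/-- The first Bernoulli function, `B₁(x) = x - ⌊x⌋ - 1/2` off ℤ, and `0` on ℤ. -/
noncomputable def B1 (x : ℝ) : ℝ := if Int.fract x = 0 then 0 else Int.fract x - 1 / 2

lemma norm_eC (w : ℂ) : ‖eC w‖ = Real.exp (-(2 * Real.pi * w.im)) := by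
  rw [eC, Complex.norm_exp]
  congr 1
  simp

lemma hasDerivAt_eC (m w : ℂ) :
    HasDerivAt (fun w => eC (m * w)) (2 * Real.pi * Complex.I * m * eC (m * w)) w := by
  unfold eC
  have h : HasDerivAt (fun w : ℂ => 2 * Real.pi * Complex.I * (m * w))
      (2 * Real.pi * Complex.I * m) w := by
    simpa using ((hasDerivAt_id w).const_mul m).const_mul (2 * Real.pi * Complex.I)
  simpa [mul_comm] using h.cexp

lemma norm_eC_le {y : ℝ} (p : ℕ+ × ℕ+) {z : ℂ} (hz : y ≤ z.im) :
    ‖eC ((p.2 : ℂ) * (p.1 : ℂ) * z)‖ ≤ Real.exp (-(2 * Real.pi * y)) ^ (p.1 * p.2 : ℕ) := by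
  rw [norm_eC, ← Real.exp_nat_mul]
  apply Real.exp_le_exp.mpr
  have h : ((p.2 : ℂ) * (p.1 : ℂ) * z).im = (p.1 * p.2 : ℕ) * z.im := by
    have : ((p.2 : ℂ) * (p.1 : ℂ)) = (((p.1 * p.2 : ℕ) : ℝ) : ℂ) := by push_cast; ring
    rw [this, Complex.im_ofReal_mul]
  rw [h]
  have : 0 ≤ ((p.1 * p.2 : ℕ) : ℝ) := by positivity
  nlinarith [mul_le_mul_of_nonneg_left hz (mul_nonneg this Real.pi_pos.le)]

lemma summable_bound {y : ℝ} (hy : 0 < y) : Summable fun p : ℕ+ × ℕ+ =>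
    (p.2 : ℝ) * Real.exp (-(2 * Real.pi * y)) ^ (p.1 * p.2 : ℕ) := by
  have h := summable_prod_mul_pow (𝕜 := ℝ) 1 (r := Real.exp (-(2 * Real.pi * y))) (by
    rw [Real.norm_eq_abs, abs_of_pos (Real.exp_pos _), Real.exp_lt_one_iff]
    have := Real.pi_pos
    simp; positivity)
  simpa using h

lemma norm_chars_le {q₁ q₂ : ℕ} (χ₁ : DirichletCharacter ℂ q₁)
    (χ₂ : DirichletCharacter ℂ q₂) (l k : ℕ) :
    ‖χ₁ ((l : ℕ) : ZMod q₁) * (starRingEnd ℂ) (χ₂ ((k : ℕ) : ZMod q₂))‖ ≤ 1 := by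
  rw [norm_mul, RCLike.norm_conj]
  exact mul_le_one₀ (χ₁.norm_le_one _) (norm_nonneg _) (χ₂.norm_le_one _)

/-- The termwise derivative, up to `2πi`. -/
noncomputable def tE {q₁ q₂ : ℕ} (χ₁ : DirichletCharacter ℂ q₁)
    (χ₂ : DirichletCharacter ℂ q₂) (z : ℂ) (p : ℕ+ × ℕ+) : ℂ :=
  χ₁ ((p.1 : ℕ) : ZMod q₁) * (starRingEnd ℂ) (χ₂ ((p.2 : ℕ) : ZMod q₂)) * (p.2 : ℂ)
      * eC ((p.2 : ℂ) * (p.1 : ℂ) * z)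

noncomputable def sE {q₁ q₂ : ℕ} (χ₁ : DirichletCharacter ℂ q₁)
    (χ₂ : DirichletCharacter ℂ q₂) (p : ℕ+ × ℕ+) (z : ℂ) : ℂ :=
  χ₁ ((p.1 : ℕ) : ZMod q₁) * (starRingEnd ℂ) (χ₂ ((p.2 : ℕ) : ZMod q₂)) / (p.1 : ℂ)
      * eC ((p.2 : ℂ) * (p.1 : ℂ) * z)

lemma norm_tE_le {q₁ q₂ : ℕ} (χ₁ : DirichletCharacter ℂ q₁)
    (χ₂ : DirichletCharacter ℂ q₂) {y : ℝ} {z : ℂ} (hz : y ≤ z.im) (p : ℕ+ × ℕ+) :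
    ‖tE χ₁ χ₂ z p‖ ≤ (p.2 : ℝ) * Real.exp (-(2 * Real.pi * y)) ^ (p.1 * p.2 : ℕ) := by
  rw [tE, norm_mul, norm_mul]
  have h1 := norm_chars_le χ₁ χ₂ p.1 p.2
  have h2 := norm_eC_le p hz
  have h3 : ‖(p.2 : ℂ)‖ = (p.2 : ℝ) := by simp
  rw [h3]
  gcongr
  exact mul_le_of_le_one_left (by positivity) h1

lemma norm_sE_le {q₁ q₂ : ℕ} (χ₁ : DirichletCharacter ℂ q₁)
    (χ₂ : DirichletCharacter ℂ q₂) {y : ℝ} {z : ℂ} (hz : y ≤ z.im) (p : ℕ+ × ℕ+) :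
    ‖sE χ₁ χ₂ p z‖ ≤ (p.2 : ℝ) * Real.exp (-(2 * Real.pi * y)) ^ (p.1 * p.2 : ℕ) := by
  rw [sE, norm_mul, norm_div]
  have h1 := norm_chars_le χ₁ χ₂ p.1 p.2
  have h2 := norm_eC_le p hz
  have h3 : ‖(p.1 : ℂ)‖ = (p.1 : ℝ) := by simp
  have h4 : (1 : ℝ) ≤ (p.1 : ℝ) := by exact_mod_cast p.1.2
  have h5 : (1 : ℝ) ≤ (p.2 : ℝ) := by exact_mod_cast p.2.2
  rw [h3]
  gcongr
  exact (div_le_one_of_le₀ (h1.trans h4) (by positivity)).trans h5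

lemma summable_tE {q₁ q₂ : ℕ} (χ₁ : DirichletCharacter ℂ q₁)
    (χ₂ : DirichletCharacter ℂ q₂) {z : ℂ} (hz : 0 < z.im) : Summable (tE χ₁ χ₂ z) :=
  .of_norm_bounded (summable_bound hz) (norm_tE_le χ₁ χ₂ le_rfl)

lemma summable_sE {q₁ q₂ : ℕ} (χ₁ : DirichletCharacter ℂ q₁)
    (χ₂ : DirichletCharacter ℂ q₂) {z : ℂ} (hz : 0 < z.im) :
    Summable (fun p => sE χ₁ χ₂ p z) :=
  .of_norm_bounded (summable_bound hz) (norm_sE_le χ₁ χ₂ le_rfl)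

lemma fE_eq {q₁ q₂ : ℕ} (χ₁ : DirichletCharacter ℂ q₁)
    (χ₂ : DirichletCharacter ℂ q₂) {z : ℂ} (hz : 0 < z.im) :
    fE χ₁ χ₂ z = ∑' p, sE χ₁ χ₂ p z := by
  rw [(summable_sE χ₁ χ₂ hz).tsum_prod]
  rfl

lemma hasDerivAt_fE {q₁ q₂ : ℕ} (χ₁ : DirichletCharacter ℂ q₁)
    (χ₂ : DirichletCharacter ℂ q₂) {z : ℂ} (hz : 0 < z.im) :
    HasDerivAt (fE χ₁ χ₂) (2 * Real.pi * Complex.I * ∑' p, tE χ₁ χ₂ z p) z := by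
  have hy : 0 < z.im / 2 := by positivity
  have ho : IsOpen {x : ℂ | z.im / 2 < x.im} := isOpen_lt continuous_const Complex.continuous_im
  have hd : HasDerivAt (fun x => ∑' p, sE χ₁ χ₂ p x)
      (∑' p, 2 * Real.pi * Complex.I * tE χ₁ χ₂ z p) z := by
    refine hasDerivAt_tsum_of_isPreconnected (t := {x : ℂ | z.im / 2 < x.im})
      (g' := fun p x => 2 * Real.pi * Complex.I * tE χ₁ χ₂ x p)
      ((summable_bound hy).mul_left (2 * Real.pi)) ho
      (convex_halfSpace_im_gt _).isPreconnected ?_ ?_ (y₀ := z) ?_ (summable_sE χ₁ χ₂ hz) ?_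
    · intro p x _
      have h := (hasDerivAt_eC ((p.2 : ℂ) * (p.1 : ℂ)) x).const_mul
        (χ₁ ((p.1 : ℕ) : ZMod q₁) * (starRingEnd ℂ) (χ₂ ((p.2 : ℕ) : ZMod q₂)) / (p.1 : ℂ))
      refine h.congr_deriv ?_
      have : (p.1 : ℂ) ≠ 0 := by simp
      rw [tE]
      field_simp
    · intro p x hx
      rw [norm_mul]
      have : ‖(2 * Real.pi * Complex.I : ℂ)‖ = 2 * Real.pi := by
        simp [abs_of_pos Real.pi_pos]
      rw [this]
      have := norm_tE_le χ₁ χ₂ (le_of_lt hx) p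
      gcongr
    · simp only [Set.mem_ofPred_eq]; linarith
    · simp only [Set.mem_ofPred_eq]; linarith
  rw [tsum_mul_left] at hd
  refine hd.congr_of_eventuallyEq ?_
  filter_upwards [(isOpen_lt continuous_const Complex.continuous_im).mem_nhds hz] with x hx
  exact fE_eq χ₁ χ₂ hx

/-- Fourier coefficients of `conj χ₂`. -/
noncomputable def hF {q₂ : ℕ} [NeZero q₂] (χ₂ : DirichletCharacter ℂ q₂) (b : ZMod q₂) : ℂ :=
  (q₂ : ℂ)⁻¹ * ∑ j : ZMod q₂, ZMod.stdAddChar (-(j * b)) * (starRingEnd ℂ) (χ₂ j)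

lemma hF_inv {q₂ : ℕ} [NeZero q₂] (χ₂ : DirichletCharacter ℂ q₂) (k : ZMod q₂) :
    ∑ b : ZMod q₂, hF χ₂ b * ZMod.stdAddChar (b * k) = (starRingEnd ℂ) (χ₂ k) := by
  have h := congrFun (LinearEquiv.symm_apply_apply (ZMod.dft (N := q₂) (E := ℂ))
    (fun j => (starRingEnd ℂ) (χ₂ j))) k
  rw [ZMod.invDFT_apply] at h
  simp only [ZMod.dft_apply, smul_eq_mul] at h
  rw [← h, Finset.mul_sum]
  refine Finset.sum_congr rfl fun b _ => ?_
  rw [hF]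
  ring

lemma hF_mul {q₂ : ℕ} [NeZero q₂] (χ₂ : DirichletCharacter ℂ q₂) {a d : ZMod q₂}
    (had : a * d = 1) (b : ZMod q₂) : hF χ₂ (d * b) = χ₂ d * hF χ₂ b := by
  have h1 : χ₂ a * χ₂ d = 1 := by rw [← map_mul, had, map_one]
  have h2 : (starRingEnd ℂ) (χ₂ a) = χ₂ d := by
    have hn : (starRingEnd ℂ) (χ₂ a) * χ₂ a = 1 := by
      have hu : IsUnit a := IsUnit.of_mul_eq_one d had
      have : ‖χ₂ a‖ = 1 := by
        obtain ⟨u, rfl⟩ := hu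
        exact χ₂.unit_norm_eq_one u
      rw [mul_comm, Complex.mul_conj, Complex.normSq_eq_norm_sq, this]; simp
    calc (starRingEnd ℂ) (χ₂ a) = (starRingEnd ℂ) (χ₂ a) * (χ₂ a * χ₂ d) := by rw [h1, mul_one]
      _ = χ₂ d := by rw [← mul_assoc, hn, one_mul]
  have hda : d * a = 1 := by rw [mul_comm, had]
  let e : ZMod q₂ ≃ ZMod q₂ :=
    ⟨fun j => a * j, fun j => d * j, fun j => by simp [← mul_assoc, hda],
      fun j => by simp [← mul_assoc, had]⟩
  rw [hF, hF, ← e.sum_comp, mul_left_comm, Finset.mul_sum (a := χ₂ d)]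
  congr 1
  refine Finset.sum_congr rfl fun j _ => ?_
  have : e j * (d * b) = j * b := by
    simp only [e, Equiv.coe_fn_mk]
    linear_combination (j * b) * had
  rw [this]
  simp only [e, Equiv.coe_fn_mk, map_mul, h2]
  ring

lemma hF_sum {q₂ : ℕ} [NeZero q₂] (hq₂ : 1 < q₂) (χ₂ : DirichletCharacter ℂ q₂) :
    ∑ b : ZMod q₂, hF χ₂ b = 0 := by
  have h := hF_inv χ₂ 0
  have : Fact (1 < q₂) := ⟨hq₂⟩
  simpa [MulChar.map_zero] using h

/-- The lattice `ℤ q₁q₂z + ℤ q₂`. -/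
noncomputable def LP (q₁ q₂ : ℕ) [NeZero q₁] [NeZero q₂] (z : ℂ) (hz : 0 < z.im) : PeriodPair where
  ω₁ := q₁ * q₂ * z
  ω₂ := q₂
  indep := by
    rw [LinearIndependent.pair_iff]
    intro s t h
    have hi := congrArg Complex.im h
    have hr := congrArg Complex.re h
    have h1 : (q₁ : ℝ) ≠ 0 := NeZero.ne _
    have h2 : (q₂ : ℝ) ≠ 0 := NeZero.ne _
    have e : ((q₁ : ℂ) * q₂ * z) = (((q₁ * q₂ : ℝ)) : ℂ) * z := by push_cast; ring
    rw [e] at hi hr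
    simp [-Complex.ofReal_mul, h1, h2, hz.ne'] at hi hr
    subst hi
    simpa [h2] using hr

lemma wp_scale (L L' : PeriodPair) (lam : ℂ) (h0 : lam ≠ 0)
    (h : ∀ x, x ∈ L'.lattice ↔ lam * x ∈ L.lattice) (u : ℂ) :
    L'.weierstrassP u = lam ^ 2 * L.weierstrassP (lam * u) := by
  let e : L'.lattice ≃ L.lattice :=
    ⟨fun x => ⟨lam * x, (h x).1 x.2⟩, fun y => ⟨lam⁻¹ * y, (h _).2 (by
      rw [mul_inv_cancel_left₀ h0]; exact y.2)⟩, fun x => by simp [h0], fun x => by simp [h0]⟩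
  rw [PeriodPair.weierstrassP, PeriodPair.weierstrassP, ← tsum_mul_left, ← e.tsum_eq]
  refine tsum_congr fun x => ?_
  simp only [e, Equiv.coe_fn_mk, ← mul_sub, mul_pow]
  field_simp

noncomputable def PP (q₁ q₂ : ℕ) [NeZero q₁] [NeZero q₂] (z : ℂ) (hz : 0 < z.im) (l n : ℤ) : ℂ :=
  (LP q₁ q₂ z hz).weierstrassP (l * q₂ * z + n)

lemma PP_congr (q₁ q₂ : ℕ) [NeZero q₁] [NeZero q₂] (z : ℂ) (hz : 0 < z.im) {l n l' n' : ℤ}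
    (hl : (l : ZMod q₁) = l') (hn : (n : ZMod q₂) = n') :
    PP q₁ q₂ z hz l n = PP q₁ q₂ z hz l' n' := by
  rw [ZMod.intCast_eq_intCast_iff_dvd_sub] at hl hn
  obtain ⟨i, hi⟩ := hl
  obtain ⟨j, hj⟩ := hn
  have hm : ((i * (q₁ * q₂ * z) + j * q₂ : ℂ)) ∈ (LP q₁ q₂ z hz).lattice :=
    PeriodPair.mem_lattice.2 ⟨i, j, rfl⟩
  have := (LP q₁ q₂ z hz).weierstrassP_add_coe (l * q₂ * z + n) ⟨_, hm⟩
  rw [PP, PP, ← this]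
  congr 1
  have hi' : (l' : ℂ) = l + q₁ * i := by
    have : l' = l + q₁ * i := by linarith
    rw [this]; push_cast; ring
  have hj' : (n' : ℂ) = n + q₂ * j := by
    have : n' = n + q₂ * j := by linarith
    rw [this]; push_cast; ring
  rw [hi', hj']
  push_cast
  ring

lemma denom_ne {c d : ℤ} (hcd : ¬ (c = 0 ∧ d = 0)) {z : ℂ} (hz : 0 < z.im) :
    (c : ℂ) * z + d ≠ 0 := by
  intro h
  have hi := congrArg Complex.im h
  simp [hz.ne'] at hi
  subst hi
  simp at h
  exact hcd ⟨rfl, h⟩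

lemma PP_mod (q₁ q₂ : ℕ) [NeZero q₁] [NeZero q₂] (a b c' d : ℤ)
    (hdet : a * d - b * (q₁ * q₂ * c') = 1)
    (z z' : ℂ) (hz : 0 < z.im) (hz' : 0 < z'.im)
    (hne : ((q₁ * q₂ * c' : ℤ) : ℂ) * z + d ≠ 0)
    (hzz : z' * (((q₁ * q₂ * c' : ℤ) : ℂ) * z + d) = a * z + b) (l n : ℤ) :
    PP q₁ q₂ z' hz' l n = (((q₁ * q₂ * c' : ℤ) : ℂ) * z + d) ^ 2 *
      PP q₁ q₂ z hz (l * a + n * (q₁ * c')) (l * q₂ * b + n * d) := by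
  rw [PP, PP, wp_scale (LP q₁ q₂ z hz) (LP q₁ q₂ z' hz') _ hne]
  · congr 2
    push_cast at hzz ⊢
    linear_combination (l * q₂ : ℂ) * hzz
  · have hdet' : (a : ℂ) * d - b * (q₁ * q₂ * c') = 1 := by exact_mod_cast hdet
    intro x
    rw [PeriodPair.mem_lattice, PeriodPair.mem_lattice]
    simp only [LP]
    push_cast at hzz hne ⊢
    constructor
    · rintro ⟨i, j, rfl⟩
      refine ⟨i * a + j * (q₂ * c'), i * (q₁ * b) + j * d, ?_⟩
      push_cast
      linear_combination (-i * q₁ * q₂ : ℂ) * hzz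
    · rintro ⟨i, j, h⟩
      refine ⟨i * d - j * (q₂ * c'), - i * (q₁ * b) + j * a, ?_⟩
      apply mul_left_cancel₀ hne
      rw [← h]
      push_cast
      linear_combination ((i * d - j * (q₂ * c')) * q₁ * q₂ : ℂ) * hzz +
        (i * q₁ * q₂ * z + j * q₂) * hdet'

noncomputable def SS {q₁ q₂ : ℕ} [NeZero q₁] [NeZero q₂] (χ₁ : DirichletCharacter ℂ q₁)
    (χ₂ : DirichletCharacter ℂ q₂) (z : ℂ) (hz : 0 < z.im) : ℂ :=
  ∑ x : ZMod q₁, ∑ y : ZMod q₂, χ₁ x * hF χ₂ y * PP q₁ q₂ z hz (x.val : ℤ) (y.val : ℤ)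

lemma conj_char {q₂ : ℕ} (χ₂ : DirichletCharacter ℂ q₂) {a d : ZMod q₂} (had : a * d = 1) :
    (starRingEnd ℂ) (χ₂ d) = χ₂ a := by
  have h1 : χ₂ a * χ₂ d = 1 := by rw [← map_mul, had, map_one]
  have hn : (starRingEnd ℂ) (χ₂ d) * χ₂ d = 1 := by
    have hu : IsUnit d := IsUnit.of_mul_eq_one a (by rw [mul_comm, had])
    have : ‖χ₂ d‖ = 1 := by
      obtain ⟨u, rfl⟩ := hu
      exact χ₂.unit_norm_eq_one u
    rw [mul_comm, Complex.mul_conj, Complex.normSq_eq_norm_sq, this]; simp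
  exact mul_right_cancel₀ (right_ne_zero_of_mul_eq_one h1) (hn.trans h1.symm)

lemma SS_mod {q₁ q₂ : ℕ} [NeZero q₁] [NeZero q₂] (χ₁ : DirichletCharacter ℂ q₁)
    (χ₂ : DirichletCharacter ℂ q₂) (a b c' d : ℤ)
    (hdet : a * d - b * (q₁ * q₂ * c') = 1)
    (z z' : ℂ) (hz : 0 < z.im) (hz' : 0 < z'.im)
    (hne : ((q₁ * q₂ * c' : ℤ) : ℂ) * z + d ≠ 0)
    (hzz : z' * (((q₁ * q₂ * c' : ℤ) : ℂ) * z + d) = a * z + b) :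
    SS χ₁ χ₂ z' hz' = (((q₁ * q₂ * c' : ℤ) : ℂ) * z + d) ^ 2 *
      (χ₁ (d : ZMod q₁) * (starRingEnd ℂ) (χ₂ (d : ZMod q₂)) * SS χ₁ χ₂ z hz) := by
  have had1 : (a : ZMod q₁) * d = 1 := by
    have := congrArg (Int.cast : ℤ → ZMod q₁) hdet
    push_cast at this; simpa using this
  have had2 : (a : ZMod q₂) * d = 1 := by
    have := congrArg (Int.cast : ℤ → ZMod q₂) hdet
    push_cast at this; simpa using this
  have hda1 : (d : ZMod q₁) * a = 1 := by rw [mul_comm, had1]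
  have hda2 : (d : ZMod q₂) * a = 1 := by rw [mul_comm, had2]
  let e₁ : ZMod q₁ ≃ ZMod q₁ :=
    ⟨fun j => d * j, fun j => a * j, fun j => by simp [← mul_assoc, had1],
      fun j => by simp [← mul_assoc, hda1]⟩
  let e₂ : ZMod q₂ ≃ ZMod q₂ :=
    ⟨fun j => a * j, fun j => d * j, fun j => by simp [← mul_assoc, hda2],
      fun j => by simp [← mul_assoc, had2]⟩
  rw [conj_char χ₂ had2, SS, SS, ← e₁.sum_comp, Finset.mul_sum, Finset.mul_sum]
  refine Finset.sum_congr rfl fun x _ => ?_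
  rw [← e₂.sum_comp, Finset.mul_sum, Finset.mul_sum]
  refine Finset.sum_congr rfl fun y _ => ?_
  rw [PP_mod q₁ q₂ a b c' d hdet z z' hz hz' hne hzz,
    PP_congr q₁ q₂ z hz (l' := (x.val : ℤ)) (n' := (y.val : ℤ))]
  · simp only [e₁, e₂, Equiv.coe_fn_mk, map_mul, hF_mul χ₂ hda2]
    ring
  · simp only [e₁, Equiv.coe_fn_mk]
    push_cast
    simp only [ZMod.natCast_val, ZMod.cast_id', id, CharP.cast_eq_zero]
    linear_combination x * had1
  · simp only [e₂, Equiv.coe_fn_mk]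
    push_cast
    simp only [ZMod.natCast_val, ZMod.cast_id', id, CharP.cast_eq_zero]
    linear_combination y * had2

lemma PP_hasSum (q₁ q₂ : ℕ) [NeZero q₁] [NeZero q₂] (z : ℂ) (hz : 0 < z.im) (l n : ℤ) :
    HasSum (fun p : ℤ × ℤ => 1 / (((l + q₁ * p.1 : ℤ) : ℂ) * q₂ * z + n + p.2 * q₂) ^ 2 -
      1 / (p.1 * (q₁ * q₂ * z) + p.2 * q₂) ^ 2) (PP q₁ q₂ z hz l n) := by
  have h := (LP q₁ q₂ z hz).hasSum_weierstrassP (l * q₂ * z + n)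
  rw [← (LP q₁ q₂ z hz).latticeEquivProd.symm.toEquiv.hasSum_iff, ← (Equiv.neg _).hasSum_iff] at h
  refine h.congr_fun ?_
  intro p
  have e : (((LP q₁ q₂ z hz).latticeEquivProd.symm.toEquiv (-p) : (LP q₁ q₂ z hz).lattice) : ℂ) =
      -(p.1 * (q₁ * q₂ * z) + p.2 * q₂) := by
    have := (LP q₁ q₂ z hz).latticeEquiv_symm_apply (-p)
    refine this.trans ?_
    simp only [LP, Prod.fst_neg, Prod.snd_neg]
    push_cast
    ring
  simp only [Function.comp_apply, Equiv.neg_apply, e]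
  push_cast
  rw [neg_sq]
  congr 3
  ring

lemma summable_inv_sq (q₂ : ℕ) [NeZero q₂] (w : ℂ) :
    Summable fun j : ℤ => 1 / (w + j * q₂) ^ 2 := by
  have h := (EisensteinSeries.linear_right_summable (w / q₂) 1 (k := 2) le_rfl).mul_left
    (((q₂ : ℂ) ^ 2)⁻¹)
  refine h.congr fun j => ?_
  have h2 : (q₂ : ℂ) ≠ 0 := NeZero.ne _
  rw [one_div, ← mul_inv]
  congr 1
  have e : ∀ t : ℂ, t ^ (2 : ℤ) = t ^ 2 := fun t => by norm_cast
  rw [e, ← mul_pow]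
  congr 1
  push_cast
  field_simp

noncomputable def AA (q₂ : ℕ) (z : ℂ) (l n : ℤ) : ℂ :=
  ∑' j : ℤ, 1 / ((l : ℂ) * q₂ * z + n + j * q₂) ^ 2

noncomputable def Phi {q₁ q₂ : ℕ} [NeZero q₂] (χ₁ : DirichletCharacter ℂ q₁)
    (χ₂ : DirichletCharacter ℂ q₂) (z : ℂ) (l : ℤ) : ℂ :=
  ∑ y : ZMod q₂, χ₁ (l : ZMod q₁) * hF χ₂ y * AA q₂ z l (y.val : ℤ)

lemma SS_hasSum {q₁ q₂ : ℕ} [NeZero q₁] [NeZero q₂] (hq₂ : 1 < q₂)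
    (χ₁ : DirichletCharacter ℂ q₁) (χ₂ : DirichletCharacter ℂ q₂) (z : ℂ) (hz : 0 < z.im) :
    HasSum (fun p : ℤ × ℤ => ∑ x : ZMod q₁, ∑ y : ZMod q₂, χ₁ x * hF χ₂ y *
      (1 / ((((x.val : ℤ) + q₁ * p.1 : ℤ) : ℂ) * q₂ * z + (y.val : ℤ) + p.2 * q₂) ^ 2))
      (SS χ₁ χ₂ z hz) := by
  have h := hasSum_sum (s := (Finset.univ : Finset (ZMod q₁))) fun x _ =>
    hasSum_sum (s := (Finset.univ : Finset (ZMod q₂))) fun y _ =>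
      (PP_hasSum q₁ q₂ z hz (x.val : ℤ) (y.val : ℤ)).mul_left (χ₁ x * hF χ₂ y)
  refine h.congr_fun ?_
  intro p
  refine Finset.sum_congr rfl fun x _ => ?_
  simp only [mul_sub, Finset.sum_sub_distrib]
  rw [← Finset.sum_mul, ← Finset.mul_sum, hF_sum hq₂]
  simp

lemma sum_zmod_fin {q : ℕ} [NeZero q] (F : ℕ → ℂ) :
    ∑ x : ZMod q, F x.val = ∑ r : Fin q, F r := by
  obtain _ | q := q
  · exact absurd rfl (NeZero.ne 0)
  · rfl

lemma SS_hasSum' {q₁ q₂ : ℕ} [NeZero q₁] [NeZero q₂] (hq₂ : 1 < q₂)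
    (χ₁ : DirichletCharacter ℂ q₁) (χ₂ : DirichletCharacter ℂ q₂) (z : ℂ) (hz : 0 < z.im) :
    HasSum (fun i : ℤ => ∑ r : Fin q₁, Phi χ₁ χ₂ z (i * q₁ + (r : ℕ))) (SS χ₁ χ₂ z hz) := by
  have key : ∀ (i : ℤ) (x : ZMod q₁) (y : ZMod q₂), HasSum (fun j : ℤ => χ₁ x * hF χ₂ y *
      (1 / ((((x.val : ℤ) + q₁ * i : ℤ) : ℂ) * q₂ * z + (y.val : ℤ) + j * q₂) ^ 2))
      (χ₁ ((i * q₁ + (x.val : ℕ) : ℤ) : ZMod q₁) * hF χ₂ y *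
        AA q₂ z (i * q₁ + (x.val : ℕ)) (y.val : ℤ)) := by
    intro i x y
    have e : ((i * q₁ + (x.val : ℕ) : ℤ) : ZMod q₁) = x := by
      push_cast
      simp
    rw [e, show (i * q₁ + (x.val : ℤ)) = (x.val : ℤ) + q₁ * i by ring]
    exact (summable_inv_sq q₂ _).hasSum.mul_left _
  have key2 : ∀ i : ℤ, HasSum (fun j : ℤ => ∑ x : ZMod q₁, ∑ y : ZMod q₂, χ₁ x * hF χ₂ y *
      (1 / ((((x.val : ℤ) + q₁ * i : ℤ) : ℂ) * q₂ * z + (y.val : ℤ) + j * q₂) ^ 2))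
      (∑ x : ZMod q₁, Phi χ₁ χ₂ z (i * q₁ + (x.val : ℕ))) := by
    intro i
    exact hasSum_sum fun x _ => hasSum_sum fun y _ => key i x y
  have h := HasSum.prod_fiberwise (SS_hasSum hq₂ χ₁ χ₂ z hz) key2
  refine h.congr_fun fun i => ?_
  exact (sum_zmod_fin (fun r => Phi χ₁ χ₂ z (i * q₁ + (r : ℕ)))).symm

lemma SS_eq_tsum {q₁ q₂ : ℕ} [NeZero q₁] [NeZero q₂] (hq₂ : 1 < q₂)
    (χ₁ : DirichletCharacter ℂ q₁) (χ₂ : DirichletCharacter ℂ q₂) (z : ℂ) (hz : 0 < z.im)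
    (hs : Summable (Phi χ₁ χ₂ z)) :
    SS χ₁ χ₂ z hz = ∑' l, Phi χ₁ χ₂ z l := by
  have h := hs.hasSum
  rw [← (Int.divModEquiv q₁).symm.hasSum_iff] at h
  have h2 := h.prod_fiberwise (g := fun i : ℤ => ∑ r : Fin q₁, Phi χ₁ χ₂ z (i * q₁ + (r : ℕ)))
    fun i => by
      have := hasSum_fintype (fun r : Fin q₁ => Phi χ₁ χ₂ z (i * q₁ + (r : ℕ)))
      exact this
  exact (SS_hasSum' hq₂ χ₁ χ₂ z hz).unique h2

lemma AA_congr (q₂ : ℕ) (z : ℂ) (l : ℤ) {n n' : ℤ} (hn : (n : ZMod q₂) = n') :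
    AA q₂ z l n = AA q₂ z l n' := by
  rw [ZMod.intCast_eq_intCast_iff_dvd_sub] at hn
  obtain ⟨j, hj⟩ := hn
  rw [AA, AA, ← (Equiv.addRight j).tsum_eq]
  refine tsum_congr fun i => ?_
  have hj' : (n' : ℂ) = n + q₂ * j := by
    have : n' = n + q₂ * j := by linarith
    rw [this]; push_cast; ring
  rw [hj', Equiv.coe_addRight]
  push_cast
  ring

lemma AA_neg (q₂ : ℕ) (z : ℂ) (l n : ℤ) : AA q₂ z (-l) (-n) = AA q₂ z l n := by
  rw [AA, AA, ← (Equiv.neg ℤ).tsum_eq]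
  refine tsum_congr fun i => ?_
  rw [Equiv.neg_apply]
  push_cast
  rw [← neg_sq]
  congr 2
  ring

lemma Phi_even {q₁ q₂ : ℕ} [NeZero q₂] (χ₁ : DirichletCharacter ℂ q₁)
    (χ₂ : DirichletCharacter ℂ q₂) (hpar : χ₁ (-1) * χ₂ (-1) = 1) (z : ℂ) :
    (Phi χ₁ χ₂ z).Even := by
  intro l
  rw [Phi, Phi, ← Equiv.sum_comp (Equiv.neg (ZMod q₂))]
  refine Finset.sum_congr rfl fun y _ => ?_
  rw [Equiv.neg_apply, AA_congr q₂ z (-l) (n' := -(y.val : ℤ)) (by simp), AA_neg,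
    neg_eq_neg_one_mul y, hF_mul χ₂ (a := -1) (by simp), Int.cast_neg,
    neg_eq_neg_one_mul (l : ZMod q₁), map_mul]
  linear_combination χ₁ (l : ZMod q₁) * hF χ₂ y * AA q₂ z l (y.val : ℤ) * hpar

lemma eC_lin (q₂ : ℕ) [NeZero q₂] (z : ℂ) (l k : ℕ+) (y : ZMod q₂) :
    Complex.exp (2 * Real.pi * Complex.I * ((l : ℂ) * z + (y.val : ℂ) / q₂)) ^ (k : ℕ) =
    ZMod.stdAddChar (y * ((k : ℕ) : ZMod q₂)) * eC ((k : ℂ) * (l : ℂ) * z) := by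
  have : y * ((k : ℕ) : ZMod q₂) = (((y.val * k : ℕ) : ℤ) : ZMod q₂) := by simp
  rw [this, ZMod.stdAddChar_coe, eC, ← Complex.exp_add, ← Complex.exp_nat_mul]
  congr 1
  push_cast
  ring

lemma AA_pos (q₂ : ℕ) [NeZero q₂] {z : ℂ} (hz : 0 < z.im) (l : ℕ+) (y : ZMod q₂) :
    HasSum (fun k : ℕ+ => -4 * (Real.pi : ℂ) ^ 2 / (q₂ : ℂ) ^ 2 * ((k : ℂ) *
      (ZMod.stdAddChar (y * ((k : ℕ) : ZMod q₂)) * eC ((k : ℂ) * (l : ℂ) * z))))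
      (AA q₂ z ((l : ℕ) : ℤ) (y.val : ℤ)) := by
  have him : 0 < ((l : ℂ) * z + (y.val : ℂ) / q₂).im := by
    have e : ((y.val : ℂ) / q₂) = (((y.val : ℝ) / q₂ : ℝ) : ℂ) := by push_cast; rfl
    have e2 : (l : ℂ) = (((l : ℕ) : ℝ) : ℂ) := by simp
    rw [Complex.add_im, e, Complex.ofReal_im, e2, Complex.im_ofReal_mul, add_zero]
    have : (0 : ℝ) < ((l : ℕ) : ℝ) := by exact_mod_cast l.2
    positivity
  have h := EisensteinSeries.qExpansion_identity_pnat (k := 1) le_rfl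
    ⟨(l : ℂ) * z + (y.val : ℂ) / q₂, him⟩
  have hsum := (summable_pow_mul_cexp 1 1 ⟨(l : ℂ) * z + (y.val : ℂ) / q₂, him⟩).comp_injective
    PNat.coe_injective
  have h2 : (q₂ : ℂ) ≠ 0 := NeZero.ne _
  have hA : AA q₂ z ((l : ℕ) : ℤ) (y.val : ℤ) = ((q₂ : ℂ) ^ 2)⁻¹ *
      ∑' n : ℤ, 1 / (((l : ℂ) * z + (y.val : ℂ) / q₂) + n) ^ (1 + 1) := by
    rw [AA, ← tsum_mul_left]
    refine tsum_congr fun j => ?_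
    rw [one_div, one_div, ← mul_inv, ← mul_pow]
    congr 2
    push_cast
    field_simp
  simp only at h
  rw [hA, h]
  have hs : Summable fun k : ℕ+ => (k : ℂ) *
      (ZMod.stdAddChar (y * ((k : ℕ) : ZMod q₂)) * eC ((k : ℂ) * (l : ℂ) * z)) := by
    refine hsum.congr fun k => ?_
    rw [← eC_lin]
    simp
  have hfin := hs.hasSum.mul_left (-4 * (Real.pi : ℂ) ^ 2 / (q₂ : ℂ) ^ 2)
  refine (congrArg (HasSum _) ?_).mpr hfin
  rw [← mul_assoc]
  congr 1
  · have := Complex.I_sq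
    simp only [Nat.factorial_one, Nat.cast_one, div_one]
    field_simp
    linear_combination (4 * (Real.pi : ℂ) ^ 2) * this
  · refine tsum_congr fun k => ?_
    rw [eC_lin, pow_one]

lemma Phi_pos {q₁ q₂ : ℕ} [NeZero q₂] (χ₁ : DirichletCharacter ℂ q₁)
    (χ₂ : DirichletCharacter ℂ q₂) {z : ℂ} (hz : 0 < z.im) (l : ℕ+) :
    HasSum (fun k : ℕ+ => -4 * (Real.pi : ℂ) ^ 2 / (q₂ : ℂ) ^ 2 * tE χ₁ χ₂ z (l, k))
      (Phi χ₁ χ₂ z ((l : ℕ) : ℤ)) := by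
  have h := hasSum_sum (s := (Finset.univ : Finset (ZMod q₂))) fun y _ =>
    (AA_pos q₂ hz l y).mul_left (χ₁ (((l : ℕ) : ℤ) : ZMod q₁) * hF χ₂ y)
  refine h.congr_fun ?_
  intro k
  rw [tE, ← hF_inv, Finset.mul_sum, Finset.sum_mul, Finset.sum_mul, Finset.mul_sum]
  refine Finset.sum_congr rfl fun y _ => ?_
  push_cast
  ring

lemma SS_eq {q₁ q₂ : ℕ} [NeZero q₁] [NeZero q₂] (hq₁ : 1 < q₁) (hq₂ : 1 < q₂)
    (χ₁ : DirichletCharacter ℂ q₁) (χ₂ : DirichletCharacter ℂ q₂)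
    (hpar : χ₁ (-1) * χ₂ (-1) = 1) (z : ℂ) (hz : 0 < z.im) :
    SS χ₁ χ₂ z hz = 2 * (-4 * (Real.pi : ℂ) ^ 2 / (q₂ : ℂ) ^ 2 * ∑' p, tE χ₁ χ₂ z p) := by
  have : Fact (1 < q₁) := ⟨hq₁⟩
  have h := ((summable_tE χ₁ χ₂ hz).mul_left
    (-4 * (Real.pi : ℂ) ^ 2 / (q₂ : ℂ) ^ 2)).hasSum.prod_fiberwise (Phi_pos χ₁ χ₂ hz)
  have h0 : Phi χ₁ χ₂ z 0 = 0 := by simp [Phi, MulChar.map_zero]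
  have hn : Summable (fun n : ℕ => Phi χ₁ χ₂ z (n : ℤ)) :=
    (summable_pnat_iff_summable_nat (f := fun n : ℕ => Phi χ₁ χ₂ z (n : ℤ))).1 h.summable
  have he := Phi_even χ₁ χ₂ hpar z
  have hs : Summable (Phi χ₁ χ₂ z) :=
    .of_nat_of_neg hn (hn.congr fun n => (he _).symm)
  rw [SS_eq_tsum hq₂ χ₁ χ₂ z hz hs, tsum_int_eq_zero_add_two_mul_tsum_pnat he hs, h0, zero_add,
    ← tsum_mul_left, ← h.tsum_eq]
  simp

lemma tE_mod {q₁ q₂ : ℕ} [NeZero q₁] [NeZero q₂] (hq₁ : 1 < q₁) (hq₂ : 1 < q₂)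
    (χ₁ : DirichletCharacter ℂ q₁) (χ₂ : DirichletCharacter ℂ q₂)
    (hpar : χ₁ (-1) * χ₂ (-1) = 1) (a b c d : ℤ)
    (hdet : a * d - b * c = 1) (hΓ : ((q₁ * q₂ : ℕ) : ℤ) ∣ c)
    (z z' : ℂ) (hz : 0 < z.im) (hz' : 0 < z'.im)
    (hne : (c : ℂ) * z + d ≠ 0) (hzz : z' * ((c : ℂ) * z + d) = a * z + b) :
    ∑' p, tE χ₁ χ₂ z' p = ((c : ℂ) * z + d) ^ 2 *
      (χ₁ (d : ZMod q₁) * (starRingEnd ℂ) (χ₂ (d : ZMod q₂)) * ∑' p, tE χ₁ χ₂ z p) := by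
  obtain ⟨c', hc⟩ := hΓ
  have hc : c = q₁ * q₂ * c' := by rw [hc]; push_cast; ring
  subst hc
  have h := SS_mod χ₁ χ₂ a b c' d hdet z z' hz hz' hne hzz
  rw [SS_eq hq₁ hq₂ χ₁ χ₂ hpar, SS_eq hq₁ hq₂ χ₁ χ₂ hpar] at h
  have h2 : (q₂ : ℂ) ≠ 0 := NeZero.ne _
  have hC : 2 * (-4 * (Real.pi : ℂ) ^ 2 / (q₂ : ℂ) ^ 2) ≠ 0 := by
    have := Real.pi_ne_zero
    simp [h2, this]
  apply mul_left_cancel₀ hC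
  linear_combination h

lemma mob_im {a b c d : ℤ} (hdet : a * d - b * c = 1) {z : ℂ} (hz : 0 < z.im) :
    0 < (((a : ℂ) * z + b) / ((c : ℂ) * z + d)).im := by
  have hne : (c : ℂ) * z + d ≠ 0 := denom_ne (by rintro ⟨rfl, rfl⟩; simp at hdet) hz
  have hd : ((a : ℝ) * d - b * c) = 1 := by exact_mod_cast hdet
  rw [Complex.div_im, ← sub_div]
  apply div_pos _ (Complex.normSq_pos.2 hne)
  have : ((a : ℂ) * z + b).im * ((c : ℂ) * z + d).re - ((a : ℂ) * z + b).re * ((c : ℂ) * z + d).im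
      = z.im := by
    simp
    linear_combination z.im * hd
  rw [this]
  exact hz

theorem phi_independent_of_z
    {q₁ q₂ : ℕ} (hq₁ : 1 < q₁) (hq₂ : 1 < q₂)
    (χ₁ : DirichletCharacter ℂ q₁) (χ₂ : DirichletCharacter ℂ q₂)
    (hχ₁ : χ₁.IsPrimitive) (hχ₂ : χ₂.IsPrimitive)
    (hpar : χ₁ (-1) * χ₂ (-1) = 1)
    (a b c d : ℤ) (hdet : a * d - b * c = 1) (hΓ : ((q₁ * q₂ : ℕ) : ℤ) ∣ c)
    (z w : ℂ) (hz : 0 < z.im) (hw : 0 < w.im) :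
    fE χ₁ χ₂ (((a : ℂ) * z + (b : ℂ)) / ((c : ℂ) * z + (d : ℂ))) -
      χ₁ ((d : ℤ) : ZMod q₁) * (starRingEnd ℂ) (χ₂ ((d : ℤ) : ZMod q₂)) * fE χ₁ χ₂ z =
    fE χ₁ χ₂ (((a : ℂ) * w + (b : ℂ)) / ((c : ℂ) * w + (d : ℂ))) -
      χ₁ ((d : ℤ) : ZMod q₁) * (starRingEnd ℂ) (χ₂ ((d : ℤ) : ZMod q₂)) * fE χ₁ χ₂ w := by
  have : NeZero q₁ := ⟨by omega⟩
  have : NeZero q₂ := ⟨by omega⟩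
  have hder : ∀ x ∈ {x : ℂ | 0 < x.im}, HasDerivAt (fun x : ℂ =>
      fE χ₁ χ₂ (((a : ℂ) * x + (b : ℂ)) / ((c : ℂ) * x + (d : ℂ))) -
      χ₁ ((d : ℤ) : ZMod q₁) * (starRingEnd ℂ) (χ₂ ((d : ℤ) : ZMod q₂)) * fE χ₁ χ₂ x) 0 x := by
    intro x hx
    have hx : 0 < x.im := hx
    have hne : (c : ℂ) * x + d ≠ 0 := denom_ne (by rintro ⟨rfl, rfl⟩; simp at hdet) hx
    have hx' := mob_im hdet hx
    have hm : HasDerivAt (fun x : ℂ => ((a : ℂ) * x + (b : ℂ)) / ((c : ℂ) * x + (d : ℂ)))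
        (1 / ((c : ℂ) * x + d) ^ 2) x := by
      have h1 : HasDerivAt (fun x : ℂ => (a : ℂ) * x + b) a x := by
        simpa using ((hasDerivAt_id x).const_mul (a : ℂ)).add_const (b : ℂ)
      have h2 : HasDerivAt (fun x : ℂ => (c : ℂ) * x + d) c x := by
        simpa using ((hasDerivAt_id x).const_mul (c : ℂ)).add_const (d : ℂ)
      refine (h1.div h2 hne).congr_deriv ?_
      have hd : ((a : ℂ) * d - b * c) = 1 := by exact_mod_cast hdet
      congr 1
      linear_combination hd
    have hf := (hasDerivAt_fE χ₁ χ₂ hx').comp x hm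
    have hg := (hasDerivAt_fE χ₁ χ₂ hx).const_mul
      (χ₁ ((d : ℤ) : ZMod q₁) * (starRingEnd ℂ) (χ₂ ((d : ℤ) : ZMod q₂)))
    refine (hf.sub hg).congr_deriv ?_
    rw [tE_mod hq₁ hq₂ χ₁ χ₂ hpar a b c d hdet hΓ x _ hx hx' hne (div_mul_cancel₀ _ hne)]
    field_simp
    ring
  have ho : IsOpen {x : ℂ | 0 < x.im} := isOpen_lt continuous_const Complex.continuous_im
  exact ho.is_const_of_deriv_eq_zero (convex_halfSpace_im_gt _).isPreconnected
    (fun x hx => (hder x hx).differentiableAt.differentiableWithinAt)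
    (fun x hx => (hder x hx).deriv) hz hw
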